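/- (Claim 2) Let k ≥ 1 and n ≥ 2 be integers and let A be a subset of [k]^n. Then there exists a compressed set B ⊆ [k]^n with |B| = |A| and |d(A)| ≥ |d(B)|. -/

import Mathlib

open Finset
open scoped Classical

/-- `R_i(x)`: the set of coordinates of `x` equal to `i`.
The ambient alphabet is `[k+1] = {0,…,k}`. -/
noncomputable def rset {k N : ℕ} (x : Fin N → Fin (k + 1)) (i : ℕ) : Finset (Fin N) :=
  Finset.univ.filter fun j => (x j : ℕ) = i

/-- the strict binary order on finite sets of coordinates:
`X <_bin Y` iff `X ≠ Y` and `max (X Δ Y) ∈ Y`. -/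
def binLT {N : ℕ} (X Y : Finset (Fin N)) : Prop :=
  ∃ m ∈ Y, m ∉ X ∧ ∀ j : Fin N, ((j ∈ X ∧ j ∉ Y) ∨ (j ∈ Y ∧ j ∉ X)) → j ≤ m

/-- the strict `≤`-order on `[k+1]^N`: `x < y` iff `|R_0(x)| > |R_0(y)|`, or
`|R_0(x)| = |R_0(y)|` and for the largest `i` with `R_i(x) ≠ R_i(y)` we have
`max (R_i(x) Δ R_i(y)) ∈ R_i(y)`. -/
def plt {k N : ℕ} (x y : Fin N → Fin (k + 1)) : Prop :=
  (rset y 0).card < (rset x 0).card ∨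
    ((rset x 0).card = (rset y 0).card ∧
      ∃ i : ℕ, binLT (rset x i) (rset y i) ∧ ∀ j : ℕ, i < j → rset x j = rset y j)

/-- the `≤`-order on `[k+1]^N`. -/
def ple {k N : ℕ} (x y : Fin N → Fin (k + 1)) : Prop := x = y ∨ plt x y

/-- `B` is an initial segment of the `≤`-order. -/
def isInitSeg {k N : ℕ} (B : Finset (Fin N → Fin (k + 1))) : Prop :=
  ∀ y ∈ B, ∀ x, ple x y → x ∈ B

/-- the `d`-shadow: all points obtained from a point of `A` by flipping one
nonzero coordinate to `0`. -/
noncomputable def dShadow {k N : ℕ} (A : Finset (Fin N → Fin (k + 1))) :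
    Finset (Fin N → Fin (k + 1)) :=
  A.biUnion fun x =>
    (Finset.univ.filter fun i => x i ≠ 0).image fun i => Function.update x i 0

/-- the initial segment of the `≤`-order on `[k+1]^N` of cardinality `m`. -/
noncomputable def initSeg (k N m : ℕ) : Finset (Fin N → Fin (k + 1)) :=
  Finset.univ.filter fun x => (Finset.univ.filter fun y => ple y x).card ≤ m

/-- the `C_s`-compression of `A ⊆ [k+1]^(n+1)`: replace each slice
`A_{s,t} = {y : t_s y ∈ A}` by the initial segment of the same size. -/
noncomputable def compress {k n : ℕ} (s : Fin (n + 1)) (A : Finset (Fin (n + 1) → Fin (k + 1))) :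
    Finset (Fin (n + 1) → Fin (k + 1)) :=
  Finset.univ.biUnion fun t : Fin (k + 1) =>
    (initSeg k n
        (Finset.univ.filter fun y : Fin n → Fin (k + 1) => s.insertNth t y ∈ A).card).image
      fun y => s.insertNth t y

/-- `A` is compressed if every `C_s`-compression fixes it. -/
def IsCompressed {k n : ℕ} (A : Finset (Fin (n + 1) → Fin (k + 1))) : Prop :=
  ∀ s : Fin (n + 1), compress s A = A

/-- `B_r`: points with exactly `r` zero coordinates. -/
noncomputable def Bexact (k N r : ℕ) : Finset (Fin N → Fin (k + 1)) :=
  Finset.univ.filter fun x => (rset x 0).card = r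

/-- `B_{≥r}`: points with at least `r` zero coordinates. -/
noncomputable def Bge (k N r : ℕ) : Finset (Fin N → Fin (k + 1)) :=
  Finset.univ.filter fun x => r ≤ (rset x 0).card

/-- `m(x)`: the largest coordinate value of `x`. -/
noncomputable def mval {k N : ℕ} (x : Fin N → Fin (k + 1)) : ℕ :=
  Finset.univ.sup fun i => (x i : ℕ)

/-- the class `C_X`: points with maximal coordinate `s`, attained exactly on `X`,
and exactly `r` zero coordinates. -/
noncomputable def classSet (k N s r : ℕ) (X : Finset (Fin N)) : Finset (Fin N → Fin (k + 1)) :=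
  Finset.univ.filter fun x => mval x = s ∧ rset x s = X ∧ (rset x 0).card = r

/-- `[m]^N = {0,…,m−1}^N`. -/
noncomputable def box (k N m : ℕ) : Finset (Fin N → Fin (k + 1)) :=
  Finset.univ.filter fun x => ∀ i, (x i : ℕ) < m

/-- `{1,…,s−1}^N`. -/
noncomputable def box1 (k N s : ℕ) : Finset (Fin N → Fin (k + 1)) :=
  Finset.univ.filter fun x => ∀ i, 1 ≤ (x i : ℕ) ∧ (x i : ℕ) ≤ s - 1

/-- `B` is a down-set. -/
def isDownSet {k N : ℕ} (B : Finset (Fin N → Fin (k + 1))) : Prop :=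
  ∀ y ∈ B, ∀ x : Fin N → Fin (k + 1), (∀ j, (x j : ℕ) ≤ (y j : ℕ)) → x ∈ B

/-! ### The order -/

/-- number of zero coordinates -/
noncomputable def nz {k N : ℕ} (x : Fin N → Fin (k + 1)) : ℕ := (rset x 0).card

/-- coordinatewise form of the order inside a level -/
def wit {k N : ℕ} (x y : Fin N → Fin (k + 1)) (p : Fin N) : Prop :=
  x p ≠ y p ∧ ∀ j, x j ≠ y j → x j < y p ∨ (x j = y p ∧ j < p)

theorem mem_rset {k N : ℕ} (x : Fin N → Fin (k + 1)) (i : ℕ) (j : Fin N) :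
    j ∈ rset x i ↔ (x j : ℕ) = i := by simp [rset]

theorem mem_rset_zero {k N : ℕ} (x : Fin N → Fin (k + 1)) (j : Fin N) :
    j ∈ rset x 0 ↔ x j = 0 := by
  rw [mem_rset, Fin.ext_iff]; simp

theorem plt_iff {k N : ℕ} (x y : Fin N → Fin (k + 1)) :
    plt x y ↔ nz y < nz x ∨ (nz x = nz y ∧ ∃ p, wit x y p) := by
  unfold plt nz
  apply or_congr Iff.rfl
  apply and_congr Iff.rfl
  constructor
  · rintro ⟨i, ⟨m, hm, hm', hmax⟩, habove⟩
    rw [mem_rset] at hm hm'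
    refine ⟨m, fun h => hm' (by rw [h]; exact hm), fun j hj => ?_⟩
    rcases lt_trichotomy (x j : ℕ) i with h | h | h
    · left; rw [Fin.lt_def]; omega
    · right
      refine ⟨Fin.ext (by omega), ?_⟩
      have h1 := hmax j (Or.inl ⟨(mem_rset _ _ _).2 h, fun h' => hj (Fin.ext (by
        rw [mem_rset] at h'; omega))⟩)
      refine lt_of_le_of_ne h1 ?_
      rintro rfl
      exact hm' h
    · have := habove _ h
      have h2 : j ∈ rset x (x j) := (mem_rset _ _ _).2 rfl
      rw [this, mem_rset] at h2
      exact absurd (Fin.ext h2.symm) hj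
  · rintro ⟨p0, hp0, h0⟩
    obtain ⟨p, hp, hmax⟩ := Finset.exists_max_image (univ.filter fun j => x j ≠ y j)
      (fun j => toLex (y j, j)) ⟨p0, by simpa using hp0⟩
    simp only [mem_filter, mem_univ, true_and] at hp hmax
    have hp0' := hmax p0 hp0
    simp only [Prod.Lex.toLex_le_toLex] at hmax hp0'
    refine ⟨y p, ⟨p, (mem_rset _ _ _).2 rfl, fun h => hp (Fin.ext ((mem_rset _ _ _).1 h)), ?_⟩, ?_⟩
    · intro j hj
      simp only [mem_rset] at hj
      rcases hj with ⟨h1, h2⟩ | ⟨h1, h2⟩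
      · have hne : x j ≠ y j := fun h => h2 (by rw [← h]; exact h1)
        have := h0 j hne
        simp only [Fin.lt_def, Fin.le_def, Fin.ext_iff] at *
        omega
      · have hne : x j ≠ y j := fun h => h2 (by rw [h]; exact h1)
        have := hmax j hne
        simp only [Fin.lt_def, Fin.le_def, Fin.ext_iff] at *
        omega
    · intro i hi
      ext l
      simp only [mem_rset]
      by_cases hne : x l = y l
      · rw [hne]
      · have h1 := h0 l hne
        have h2 := hmax l hne
        simp only [Fin.lt_def, Fin.le_def, Fin.ext_iff] at *
        omega

/-- the set of pairs (value, position) -/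
noncomputable def code {k N : ℕ} (x : Fin N → Fin (k + 1)) : Finset (Fin (k + 1) ×ₗ Fin N) :=
  univ.image fun j => toLex (x j, j)

theorem mem_code {k N : ℕ} (x : Fin N → Fin (k + 1)) (a : Fin (k + 1)) (j : Fin N) :
    toLex (a, j) ∈ code x ↔ x j = a := by
  simp only [code, mem_image, mem_univ, true_and, EmbeddingLike.apply_eq_iff_eq, Prod.mk.injEq]
  constructor
  · rintro ⟨i, h, rfl⟩; exact h
  · intro h; exact ⟨j, h, rfl⟩

noncomputable def key {k N : ℕ} (x : Fin N → Fin (k + 1)) :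
    ℕᵒᵈ ×ₗ Colex (Finset (Fin (k + 1) ×ₗ Fin N)) :=
  toLex (OrderDual.toDual (nz x), toColex (code x))

theorem key_inj {k N : ℕ} {x y : Fin N → Fin (k + 1)} (h : key x = key y) : x = y := by
  simp only [key, EmbeddingLike.apply_eq_iff_eq, Prod.mk.injEq] at h
  have h2 : code x = code y := by simpa using h.2
  funext j
  have : toLex (y j, j) ∈ code x := by rw [h2, mem_code]
  rwa [mem_code] at this

theorem plt_key {k N : ℕ} (x y : Fin N → Fin (k + 1)) : plt x y ↔ key x < key y := by
  rw [plt_iff, key, key, Prod.Lex.toLex_lt_toLex]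
  apply or_congr
  · simp
  · apply and_congr
    · simp
    · rw [Finset.Colex.toColex_lt_toColex_iff_exists_forall_lt]
      constructor
      · rintro ⟨p, hp, h⟩
        refine ⟨toLex (y p, p), (mem_code _ _ _).2 rfl, fun h' => hp ((mem_code _ _ _).1 h'), ?_⟩
        intro b hb hb'
        obtain ⟨a, j⟩ := b
        change toLex (a, j) ∈ _ at hb
        change toLex (a, j) ∉ _ at hb'
        change toLex (a, j) < _
        rw [mem_code] at hb hb'
        rw [Prod.Lex.toLex_lt_toLex]
        subst hb
        exact h j (fun h => hb' h.symm)
      · rintro ⟨⟨a, p⟩, ha, ha', h⟩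
        change toLex (a, p) ∈ _ at ha
        change toLex (a, p) ∉ _ at ha'
        rw [mem_code] at ha ha'
        subst ha
        refine ⟨p, ha', fun j hj => ?_⟩
        have := h (toLex (x j, j)) ((mem_code _ _ _).2 rfl) (fun h' => hj ((mem_code _ _ _).1 h').symm)
        change toLex (x j, j) < toLex (y p, p) at this
        rwa [Prod.Lex.toLex_lt_toLex] at this

theorem ple_key {k N : ℕ} (x y : Fin N → Fin (k + 1)) : ple x y ↔ key x ≤ key y := by
  rw [ple, plt_key, le_iff_eq_or_lt]
  exact or_congr ⟨fun h => h ▸ rfl, key_inj⟩ Iff.rfl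

/-- rank in the order -/
noncomputable def rk {k N : ℕ} (x : Fin N → Fin (k + 1)) : ℕ :=
  (univ.filter fun y => ple y x).card

theorem rk_lt_of_plt {k N : ℕ} {x y : Fin N → Fin (k + 1)} (h : plt x y) : rk x < rk y := by
  apply card_lt_card
  rw [Finset.ssubset_iff_of_subset]
  · refine ⟨y, ?_, ?_⟩
    · exact mem_filter.2 ⟨mem_univ _, Or.inl rfl⟩
    · simp only [mem_filter, mem_univ, true_and, ple_key, not_le]
      rwa [← plt_key]
  · intro z
    simp only [mem_filter, mem_univ, true_and, ple_key]
    rw [plt_key] at h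
    intro hz; exact hz.trans h.le

theorem plt_rk {k N : ℕ} (x y : Fin N → Fin (k + 1)) : plt x y ↔ rk x < rk y := by
  refine ⟨rk_lt_of_plt, fun h => ?_⟩
  rw [plt_key]
  by_contra hc
  rcases (not_lt.1 hc).lt_or_eq with h1 | h1
  · have := rk_lt_of_plt ((plt_key _ _).2 h1); omega
  · rw [key_inj h1] at h; omega

theorem rk_inj {k N : ℕ} {x y : Fin N → Fin (k + 1)} (h : rk x = rk y) : x = y := by
  apply key_inj
  rcases lt_trichotomy (key x) (key y) with h1 | h1 | h1
  · have := rk_lt_of_plt ((plt_key _ _).2 h1); omega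
  · exact h1
  · have := rk_lt_of_plt ((plt_key _ _).2 h1); omega

theorem ple_rk {k N : ℕ} (x y : Fin N → Fin (k + 1)) : ple x y ↔ rk x ≤ rk y := by
  rw [ple, plt_rk, le_iff_eq_or_lt]
  exact or_congr ⟨fun h => h ▸ rfl, rk_inj⟩ Iff.rfl

theorem mem_initSeg {k N m : ℕ} (x : Fin N → Fin (k + 1)) : x ∈ initSeg k N m ↔ rk x ≤ m := by
  simp [initSeg, rk]

theorem initSeg_isInitSeg (k N m : ℕ) : isInitSeg (initSeg k N m) := by
  intro y hy x hxy
  rw [mem_initSeg] at *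
  rw [ple_rk] at hxy
  omega

theorem rk_image (k N : ℕ) : (univ : Finset (Fin N → Fin (k + 1))).image rk
    = Finset.Icc 1 (Fintype.card (Fin N → Fin (k + 1))) := by
  apply Finset.eq_of_subset_of_card_le
  · intro r
    simp only [mem_image, mem_univ, true_and, Finset.mem_Icc]
    rintro ⟨x, rfl⟩
    refine ⟨Finset.card_pos.2 ⟨x, mem_filter.2 ⟨mem_univ _, Or.inl rfl⟩⟩, Finset.card_le_univ _⟩
  · rw [Finset.card_image_of_injective _ (fun x y h => rk_inj h)]
    simp

theorem card_initSeg {k N m : ℕ} (hm : m ≤ Fintype.card (Fin N → Fin (k + 1))) :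
    (initSeg k N m).card = m := by
  have : (initSeg k N m).image rk = Finset.Icc 1 m := by
    ext r
    simp only [mem_image, mem_initSeg, Finset.mem_Icc]
    constructor
    · rintro ⟨x, hx, rfl⟩
      exact ⟨Finset.card_pos.2 ⟨x, mem_filter.2 ⟨mem_univ _, Or.inl rfl⟩⟩, hx⟩
    · rintro ⟨h1, h2⟩
      have : r ∈ (univ : Finset (Fin N → Fin (k + 1))).image rk := by
        rw [rk_image]; simp only [Finset.mem_Icc]; omega
      obtain ⟨x, -, rfl⟩ := mem_image.1 this
      exact ⟨x, h2, rfl⟩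
  rw [← Finset.card_image_of_injective _ (fun x y h => rk_inj h), this]
  simp

theorem card_initSeg_card {k N : ℕ} (A : Finset (Fin N → Fin (k + 1))) :
    (initSeg k N A.card).card = A.card := card_initSeg (Finset.card_le_univ _)

theorem initSeg_nested {k N : ℕ} {B C : Finset (Fin N → Fin (k + 1))} (hB : isInitSeg B)
    (hC : isInitSeg C) : B ⊆ C ∨ C ⊆ B := by
  by_contra h
  push Not at h
  obtain ⟨h1, h2⟩ := h
  obtain ⟨b, hb, hb'⟩ := Finset.not_subset.1 h1
  obtain ⟨c, hc, hc'⟩ := Finset.not_subset.1 h2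
  rcases le_total (rk b) (rk c) with h | h
  · exact hb' (hC c hc b ((ple_rk _ _).2 h))
  · exact hc' (hB b hb c ((ple_rk _ _).2 h))

theorem initSeg_unique {k N : ℕ} {B : Finset (Fin N → Fin (k + 1))} (hB : isInitSeg B) :
    initSeg k N B.card = B := by
  rcases initSeg_nested hB (initSeg_isInitSeg k N B.card) with h | h
  · exact (Finset.eq_of_subset_of_card_le h (card_initSeg_card B).le).symm
  · exact Finset.eq_of_subset_of_card_le h (card_initSeg_card B).ge

/-- Initial segments minimise strictly monotone weights. -/
theorem sum_initSeg_le {k N : ℕ} (g : (Fin N → Fin (k + 1)) → ℕ)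
    (hg : ∀ x y, plt x y → g x < g y) (A : Finset (Fin N → Fin (k + 1))) :
    ∑ x ∈ initSeg k N A.card, g x ≤ ∑ x ∈ A, g x ∧
    (initSeg k N A.card ≠ A → ∑ x ∈ initSeg k N A.card, g x < ∑ x ∈ A, g x) := by
  set I := initSeg k N A.card with hI
  have hc : I.card = A.card := card_initSeg_card A
  have key : I ≠ A → ∑ x ∈ I, g x < ∑ x ∈ A, g x := by
    intro hne
    have h1 : (I \ A).card = (A \ I).card := Finset.card_sdiff_comm hc
    have hnon : (A \ I).Nonempty := by
      rw [Finset.sdiff_nonempty]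
      intro hs
      exact hne (Finset.eq_of_subset_of_card_le hs hc.le).symm
    have hnon' : (I \ A).Nonempty := by
      rw [← Finset.card_pos, h1, Finset.card_pos]; exact hnon
    obtain ⟨b, hb, hbmin⟩ := Finset.exists_min_image (A \ I) g hnon
    have h2 : ∑ x ∈ I \ A, g x < ∑ x ∈ A \ I, g x := by
      calc ∑ x ∈ I \ A, g x < ∑ x ∈ I \ A, g b := by
            apply Finset.sum_lt_sum_of_nonempty hnon'
            intro a ha
            apply hg
            rw [plt_rk]
            simp only [mem_sdiff] at ha hb
            have h3 := ha.1
            have h4 := hb.2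
            rw [hI, mem_initSeg] at h3 h4
            omega
        _ = ∑ x ∈ A \ I, g b := by simp [h1]
        _ ≤ _ := Finset.sum_le_sum hbmin
    have e1 := Finset.sum_inter_add_sum_sdiff I A g
    have e2 := Finset.sum_inter_add_sum_sdiff A I g
    rw [Finset.inter_comm] at e2
    omega
  refine ⟨?_, key⟩
  by_cases h : I = A
  · rw [h]
  · exact (key h).le
/-! ### Slices -/

/-- the cslice `A_{s,t}` -/
noncomputable def cslice {k n : ℕ} (s : Fin (n + 1)) (t : Fin (k + 1))
    (A : Finset (Fin (n + 1) → Fin (k + 1))) : Finset (Fin n → Fin (k + 1)) :=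
  Finset.univ.filter fun y : Fin n → Fin (k + 1) => s.insertNth t y ∈ A

theorem mem_cslice {k n : ℕ} (s : Fin (n + 1)) (t : Fin (k + 1))
    (A : Finset (Fin (n + 1) → Fin (k + 1))) (y : Fin n → Fin (k + 1)) :
    y ∈ cslice s t A ↔ (s.insertNth t y : Fin (n + 1) → Fin (k + 1)) ∈ A := by
  simp [cslice]

theorem exists_insertNth {k n : ℕ} (s : Fin (n + 1)) (x : Fin (n + 1) → Fin (k + 1)) :
    ∃ y : Fin n → Fin (k + 1), x = s.insertNth (x s) y :=
  ⟨s.removeNth x, (Fin.insertNth_self_removeNth s x).symm⟩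

theorem insertNth_inj' {k n : ℕ} {s : Fin (n + 1)} {t t' : Fin (k + 1)}
    {y y' : Fin n → Fin (k + 1)}
    (h : (s.insertNth t y : Fin (n + 1) → Fin (k + 1)) = s.insertNth t' y') : t = t' ∧ y = y' := by
  refine ⟨?_, ?_⟩
  · have := congrFun h s; simpa using this
  · funext j; have := congrFun h (s.succAbove j); simpa using this

theorem sum_slice {k n : ℕ} (s : Fin (n + 1)) (A : Finset (Fin (n + 1) → Fin (k + 1)))
    (f : (Fin (n + 1) → Fin (k + 1)) → ℕ) :
    ∑ x ∈ A, f x = ∑ t : Fin (k + 1), ∑ y ∈ cslice s t A, f (s.insertNth t y) := by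
  rw [← Finset.sum_fiberwise A (fun x => x s) f]
  refine Finset.sum_congr rfl fun t _ => ?_
  symm
  refine Finset.sum_bij (fun y _ => s.insertNth t y) ?_ ?_ ?_ ?_
  · intro y hy
    rw [mem_cslice] at hy
    simp [hy]
  · intro a _ b _ h
    exact (insertNth_inj' h).2
  · intro x hx
    obtain ⟨hxA, rfl⟩ := mem_filter.1 hx
    obtain ⟨y, hy⟩ := exists_insertNth s x
    exact ⟨y, by rw [mem_cslice, ← hy]; exact hxA, hy.symm⟩
  · intro _ _; rfl

theorem card_cslice {k n : ℕ} (s : Fin (n + 1)) (A : Finset (Fin (n + 1) → Fin (k + 1))) :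
    A.card = ∑ t : Fin (k + 1), (cslice s t A).card := by
  simpa using sum_slice s A (fun _ => 1)

theorem slice_ext {k n : ℕ} (s : Fin (n + 1)) {A B : Finset (Fin (n + 1) → Fin (k + 1))}
    (h : ∀ t, cslice s t A = cslice s t B) : A = B := by
  ext x
  obtain ⟨y, hy⟩ := exists_insertNth s x
  rw [hy, ← mem_cslice, ← mem_cslice, h]

theorem slice_compress {k n : ℕ} (s : Fin (n + 1)) (t : Fin (k + 1))
    (A : Finset (Fin (n + 1) → Fin (k + 1))) :
    cslice s t (compress s A) = initSeg k n (cslice s t A).card := by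
  ext y
  rw [mem_cslice]
  simp only [compress, mem_biUnion, mem_univ, true_and, mem_image]
  constructor
  · rintro ⟨t', y', hy', h⟩
    obtain ⟨rfl, rfl⟩ := insertNth_inj' h
    exact hy'
  · intro h
    exact ⟨t, y, h, rfl⟩

theorem card_compress {k n : ℕ} (s : Fin (n + 1)) (A : Finset (Fin (n + 1) → Fin (k + 1))) :
    (compress s A).card = A.card := by
  rw [card_cslice s, card_cslice s A]
  refine Finset.sum_congr rfl fun t _ => ?_
  rw [slice_compress, card_initSeg_card]

theorem nz_insertNth {k n : ℕ} (s : Fin (n + 1)) (t : Fin (k + 1)) (y : Fin n → Fin (k + 1)) :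
    nz (s.insertNth t y : Fin (n + 1) → Fin (k + 1)) = (if t = 0 then 1 else 0) + nz y := by
  have h : ∀ (N : ℕ) (x : Fin N → Fin (k + 1)), nz x = ∑ j, if x j = 0 then 1 else 0 := by
    intro N x
    rw [← Finset.card_filter, nz]
    congr 1
    ext j
    rw [mem_rset_zero]; simp
  rw [h, h, Fin.sum_univ_succAbove _ s]
  simp

theorem plt_insertNth {k n : ℕ} (s : Fin (n + 1)) (t : Fin (k + 1)) (x y : Fin n → Fin (k + 1)) :
    plt (s.insertNth t x : Fin (n + 1) → Fin (k + 1)) (s.insertNth t y) ↔ plt x y := by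
  rw [plt_iff, plt_iff, nz_insertNth, nz_insertNth]
  apply or_congr (by omega)
  apply and_congr (by omega)
  rw [Fin.exists_iff_succAbove s]
  simp only [wit]
  simp [Fin.forall_iff_succAbove s, (Fin.strictMono_succAbove s).lt_iff_lt]

theorem isInitSeg_slice {k n : ℕ} {s : Fin (n + 1)} {t : Fin (k + 1)}
    {A : Finset (Fin (n + 1) → Fin (k + 1))} (hA : isInitSeg A) : isInitSeg (cslice s t A) := by
  intro y hy x hxy
  rw [mem_cslice] at *
  refine hA _ hy _ ?_
  rcases hxy with rfl | h
  · exact Or.inl rfl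
  · exact Or.inr ((plt_insertNth _ _ _ _).2 h)

theorem isCompressed_of_isInitSeg {k n : ℕ} {A : Finset (Fin (n + 1) → Fin (k + 1))}
    (hA : isInitSeg A) : IsCompressed A := by
  intro s
  apply slice_ext s
  intro t
  rw [slice_compress, initSeg_unique (isInitSeg_slice hA)]

theorem compress_sum_lt {k n : ℕ} (s : Fin (n + 1)) (A : Finset (Fin (n + 1) → Fin (k + 1)))
    (hne : compress s A ≠ A) : ∑ x ∈ compress s A, rk x < ∑ x ∈ A, rk x := by
  rw [sum_slice s, sum_slice s A]
  have hg : ∀ t : Fin (k + 1), ∀ x y : Fin n → Fin (k + 1), plt x y →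
      rk (s.insertNth t x : Fin (n + 1) → Fin (k + 1)) < rk (s.insertNth t y) := by
    intro t x y h
    rw [← plt_rk]
    exact (plt_insertNth _ _ _ _).2 h
  apply Finset.sum_lt_sum
  · intro t _
    rw [slice_compress]
    exact (sum_initSeg_le _ (hg t) (cslice s t A)).1
  · by_contra hc
    apply hne
    apply slice_ext s
    intro t
    by_contra ht
    refine hc ⟨t, mem_univ _, ?_⟩
    rw [slice_compress] at ht ⊢
    exact (sum_initSeg_le _ (hg t) (cslice s t A)).2 ht

/-- the consequence of being compressed that we use -/
def HP {k N : ℕ} (A : Finset (Fin N → Fin (k + 1))) : Prop :=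
  ∀ u ∈ A, ∀ v, plt v u → (∃ s, u s = v s) → v ∈ A

theorem HP_of_isCompressed {k n : ℕ} {A : Finset (Fin (n + 1) → Fin (k + 1))}
    (hA : IsCompressed A) : HP A := by
  rintro u hu v hvu ⟨s, hs⟩
  obtain ⟨u', hu'⟩ := exists_insertNth s u
  obtain ⟨v', hv'⟩ := exists_insertNth s v
  rw [← hs] at hv'
  have h1 : u' ∈ cslice s (u s) A := by rw [mem_cslice, ← hu']; exact hu
  have h2 : v' ∈ cslice s (u s) A := by
    rw [← hA s, slice_compress] at h1 ⊢
    refine initSeg_isInitSeg _ _ _ _ h1 _ (Or.inr ?_)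
    rw [hu', hv'] at hvu
    simpa [plt_insertNth] using hvu
  rw [mem_cslice, ← hv'] at h2
  exact h2

/-! ### The shadow -/

theorem mem_dShadow {k N : ℕ} {A : Finset (Fin N → Fin (k + 1))} {w : Fin N → Fin (k + 1)} :
    w ∈ dShadow A ↔ ∃ x ∈ A, ∃ i, x i ≠ 0 ∧ Function.update x i 0 = w := by
  simp [dShadow]

theorem slice_dShadow_zero {k n : ℕ} (s : Fin (n + 1)) (A : Finset (Fin (n + 1) → Fin (k + 1))) :
    cslice s 0 (dShadow A) = dShadow (cslice s 0 A) ∪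
      (univ.filter fun t : Fin (k + 1) => t ≠ 0).biUnion fun t => cslice s t A := by
  ext y
  simp only [mem_cslice, mem_dShadow, mem_union, mem_biUnion, mem_filter, mem_univ, true_and]
  constructor
  · rintro ⟨x, hx, i, hi, h⟩
    obtain ⟨x', hx'⟩ := exists_insertNth s x
    rcases Fin.eq_self_or_eq_succAbove s i with rfl | ⟨j, rfl⟩
    · right
      refine ⟨x i, hi, ?_⟩
      have : x' = y := by
        rw [hx', Fin.update_insertNth] at h
        exact (insertNth_inj' h).2
      rw [← this, ← hx']; exact hx
    · left
      have h0 : x s = 0 := by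
        have := congrFun h s
        simpa [Fin.ne_succAbove] using this
      rw [h0] at hx'
      rw [hx', ← Fin.insertNth_update] at h
      rw [hx'] at hx hi
      exact ⟨x', hx, j, by simpa using hi, (insertNth_inj' h).2⟩
  · rintro (⟨x, hx, i, hi, rfl⟩ | ⟨t, ht, h⟩)
    · refine ⟨_, hx, s.succAbove i, by simpa using hi, by simp⟩
    · exact ⟨_, h, s, by simpa using ht, by simp⟩

theorem slice_dShadow_ne {k n : ℕ} (s : Fin (n + 1)) (t : Fin (k + 1)) (ht : t ≠ 0)
    (A : Finset (Fin (n + 1) → Fin (k + 1))) :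
    cslice s t (dShadow A) = dShadow (cslice s t A) := by
  ext y
  simp only [mem_cslice, mem_dShadow]
  constructor
  · rintro ⟨x, hx, i, hi, h⟩
    obtain ⟨x', hx'⟩ := exists_insertNth s x
    rcases Fin.eq_self_or_eq_succAbove s i with rfl | ⟨j, rfl⟩
    · have := congrFun h i
      simp at this
      exact absurd this.symm ht
    · have h0 : x s = t := by
        have := congrFun h s
        simpa [Fin.ne_succAbove] using this
      rw [h0] at hx'
      rw [hx', ← Fin.insertNth_update] at h
      rw [hx'] at hx hi
      exact ⟨x', hx, j, by simpa using hi, (insertNth_inj' h).2⟩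
  · rintro ⟨x, hx, i, hi, rfl⟩
    exact ⟨_, hx, s.succAbove i, by simpa using hi, by simp⟩

theorem isInitSeg_union {k N : ℕ} {A B : Finset (Fin N → Fin (k + 1))} (hA : isInitSeg A)
    (hB : isInitSeg B) : isInitSeg (A ∪ B) := by
  intro y hy x hxy
  rcases mem_union.1 hy with h | h
  · exact mem_union_left _ (hA y h x hxy)
  · exact mem_union_right _ (hB y h x hxy)
/-! ### Points -/

theorem nz_update_zero {k N : ℕ} (x : Fin N → Fin (k + 1)) (i : Fin N) (h : x i ≠ 0) :
    nz (Function.update x i 0) = nz x + 1 := by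
  have : rset (Function.update x i 0) 0 = insert i (rset x 0) := by
    ext j
    rw [mem_insert, mem_rset_zero, mem_rset_zero]
    by_cases hj : j = i
    · subst hj; simp
    · simp [hj]
  rw [nz, this, card_insert_of_notMem (by rw [mem_rset_zero]; exact h), nz]

theorem nz_update_of_zero {k N : ℕ} (x : Fin N → Fin (k + 1)) (i : Fin N) (c : Fin (k + 1))
    (h : x i = 0) (hc : c ≠ 0) : nz (Function.update x i c) + 1 = nz x := by
  rw [← nz_update_zero _ i (by simpa using hc)]
  simp [← h]

theorem nz_update_same {k N : ℕ} (x : Fin N → Fin (k + 1)) (i : Fin N) (c : Fin (k + 1))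
    (h : x i ≠ 0) (hc : c ≠ 0) : nz (Function.update x i c) = nz x := by
  have h1 := nz_update_zero (Function.update x i c) i (by simpa using hc)
  have h2 := nz_update_zero x i h
  rw [Function.update_idem] at h1
  omega

theorem nz_pos {k N : ℕ} {x : Fin N → Fin (k + 1)} : 0 < nz x ↔ ∃ i, x i = 0 := by
  rw [nz, card_pos]
  simp only [Finset.Nonempty, mem_rset_zero]

theorem plt_irrefl {k N : ℕ} (x : Fin N → Fin (k + 1)) : ¬ plt x x := by
  rw [plt_rk]; omega

theorem plt_trans {k N : ℕ} {x y z : Fin N → Fin (k + 1)} (h : plt x y) (h' : plt y z) :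
    plt x z := by
  rw [plt_rk] at *; omega

theorem plt_total {k N : ℕ} (x y : Fin N → Fin (k + 1)) : plt x y ∨ x = y ∨ plt y x := by
  rw [plt_rk, plt_rk]
  rcases lt_trichotomy (rk x) (rk y) with h | h | h
  · exact Or.inl h
  · exact Or.inr (Or.inl (rk_inj h))
  · exact Or.inr (Or.inr h)

theorem plt_of_wit {k N : ℕ} {x y : Fin N → Fin (k + 1)} (h : nz x = nz y) (p : Fin N)
    (hp : wit x y p) : plt x y := (plt_iff _ _).2 (Or.inr ⟨h, p, hp⟩)

theorem nz_le_of_plt {k N : ℕ} {x y : Fin N → Fin (k + 1)} (h : plt x y) : nz y ≤ nz x := by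
  rcases (plt_iff _ _).1 h with h | h <;> omega

theorem exists_wit {k N : ℕ} {x y : Fin N → Fin (k + 1)} (h : plt x y) (hn : nz x = nz y) :
    ∃ p, wit x y p ∧ ∀ j, x j ≠ y j → y j < y p ∨ (y j = y p ∧ j ≤ p) := by
  rcases (plt_iff _ _).1 h with h | ⟨-, p0, hp0, h0⟩
  · omega
  · obtain ⟨p, hp, hmax⟩ := Finset.exists_max_image (univ.filter fun j => x j ≠ y j)
      (fun j => toLex (y j, j)) ⟨p0, by simpa using hp0⟩
    simp only [mem_filter, mem_univ, true_and] at hp hmax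
    have hp0' := hmax p0 hp0
    simp only [Prod.Lex.toLex_le_toLex] at hmax hp0'
    refine ⟨p, ⟨hp, fun j hj => ?_⟩, hmax⟩
    have := h0 j hj
    simp only [Fin.lt_def, Fin.le_def, Fin.ext_iff] at *
    omega

theorem plt_update {k N : ℕ} (x : Fin N → Fin (k + 1)) (i : Fin N) (c : Fin (k + 1))
    (h : x i ≠ 0) (hc : x i < c) : plt x (Function.update x i c) := by
  have hc0 : c ≠ 0 := by rintro rfl; simp at hc
  refine plt_of_wit (nz_update_same x i c h hc0).symm i ⟨?_, ?_⟩
  · simpa using hc.ne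
  · intro j hj
    by_cases hji : j = i
    · subst hji; left; simpa using hc
    · simp [hji] at hj

theorem update_plt {k N : ℕ} (x : Fin N → Fin (k + 1)) (i : Fin N) (c : Fin (k + 1))
    (h : c ≠ 0) (hc : c < x i) : plt (Function.update x i c) x := by
  have := plt_update (Function.update x i c) i (x i) (by simpa using h) (by simpa using hc)
  simpa using this

/-- position `s` contributes a new shadow point -/
def good {k N : ℕ} (x : Fin N → Fin (k + 1)) (s : Fin N) : Prop :=
  (x s : ℕ) = 1 ∧ ∀ u < s, x u ≠ 0

theorem parent_ge {k N : ℕ} {x z : Fin N → Fin (k + 1)} {i j : Fin N} (hx : good x j)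
    (hz : z i ≠ 0) (h : Function.update z i 0 = Function.update x j 0) : z = x ∨ plt x z := by
  obtain ⟨h1, h2⟩ := hx
  have hxj : x j ≠ 0 := by intro h; rw [h] at h1; simp at h1
  have hl : ∀ l, l ≠ i → l ≠ j → z l = x l := by
    intro l hi hj
    have := congrFun h l
    simpa [hi, hj] using this
  by_cases hij : i = j
  · subst hij
    by_cases he : z i = x i
    · left; funext l
      by_cases hli : l = i
      · rw [hli, he]
      · exact hl l hli hli
    · right
      have : z = Function.update x i (z i) := by
        funext l
        by_cases hli : l = i
        · subst hli; simp
        · simp [hli, hl l hli hli]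
      rw [this]
      apply plt_update _ _ _ hxj
      simp only [Fin.lt_def, Fin.ext_iff, Fin.val_zero, ne_eq] at *
      omega
  · right
    have hi0 : x i = 0 := by
      have := congrFun h i
      simpa [hij] using this.symm
    have hj0 : z j = 0 := by
      have := congrFun h j
      simpa [Ne.symm hij] using this
    have hji : j < i := by
      by_contra hc
      exact h2 i (lt_of_le_of_ne (not_lt.1 hc) hij) hi0
    have hn : nz x = nz z := by
      have e1 := nz_update_zero z i hz
      have e2 := nz_update_zero x j hxj
      rw [h] at e1; omega
    refine plt_of_wit hn i ⟨by rw [hi0]; exact hz.symm, ?_⟩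
    intro l hl'
    by_cases hli : l = i
    · subst hli; left; rw [hi0]; exact Fin.pos_iff_ne_zero.2 hz
    · by_cases hlj : l = j
      · subst hlj
        simp only [Fin.lt_def, Fin.ext_iff, Fin.val_zero, ne_eq] at *
        omega
      · exact absurd (hl l hli hlj).symm hl'

theorem good_update {k N : ℕ} {w : Fin N → Fin (k + 1)} {u : Fin N} {one : Fin (k + 1)}
    (h1 : (one : ℕ) = 1) (h2 : ∀ v < u, w v ≠ 0) : good (Function.update w u one) u := by
  refine ⟨by simpa using h1, fun v hv => ?_⟩
  rw [Function.update_of_ne hv.ne]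
  exact h2 v hv

theorem exists_first_zero {k N : ℕ} {w : Fin N → Fin (k + 1)} (h : ∃ i, w i = 0) :
    ∃ u, w u = 0 ∧ ∀ v < u, w v ≠ 0 := by
  obtain ⟨i, hi⟩ := h
  obtain ⟨u, hu, hmin⟩ := Finset.exists_min_image (univ.filter fun j => w j = 0) id
    ⟨i, by simpa using hi⟩
  simp only [mem_filter, mem_univ, true_and, id] at hu hmin
  exact ⟨u, hu, fun v hv h => absurd (hmin v h) (not_le.2 hv)⟩

theorem zmin_mono {k N : ℕ} {a b : Fin N → Fin (k + 1)} {u v : Fin N} {one : Fin (k + 1)}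
    (h1 : (one : ℕ) = 1) (ha : a u = 0) (ha' : ∀ l < u, a l ≠ 0) (hb : b v = 0)
    (hb' : ∀ l < v, b l ≠ 0) (hab : plt a b) :
    ple (Function.update a u one) (Function.update b v one) := by
  have hone : one ≠ 0 := by intro h; rw [h] at h1; simp at h1
  have e1 := nz_update_of_zero a u one ha hone
  have e2 := nz_update_of_zero b v one hb hone
  have e3 := nz_le_of_plt hab
  by_cases hn : nz a = nz b
  swap
  · right; rw [plt_iff]; left; omega
  obtain ⟨p, ⟨hp, hw⟩, hmax⟩ := exists_wit hab hn
  have hbp : b p ≠ 0 := by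
    intro h
    have := hw p hp
    simp only [Fin.lt_def, Fin.ext_iff, Fin.val_zero, ne_eq] at *
    omega
  have hvp : p ≠ v := by rintro rfl; exact hbp hb
  have A1 : ∀ l, l ≠ u → (Function.update a u one) l = a l := fun l hl => by simp [hl]
  have A2 : (Function.update a u one) u = one := by simp
  have B1 : ∀ l, l ≠ v → (Function.update b v one) l = b l := fun l hl => by simp [hl]
  have B2 : (Function.update b v one) v = one := by simp
  by_cases hb2 : 2 ≤ (b p : ℕ)
  · right
    refine plt_of_wit (by omega) p ⟨?_, ?_⟩
    · rw [B1 p hvp]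
      by_cases hpu : p = u
      · rw [hpu, A2, ← hpu]; intro h; rw [← h] at hb2; omega
      · rw [A1 p hpu]; exact hp
    · intro j hj
      rw [B1 p hvp]
      by_cases hju : j = u
      · rw [hju, A2]; left; rw [Fin.lt_def]; omega
      · rw [A1 j hju] at hj ⊢
        by_cases hab' : a j = b j
        · have : j = v := by
            by_contra hjv
            rw [B1 j hjv] at hj; exact hj hab'
          subst this
          left; rw [hab', hb]; exact Fin.pos_iff_ne_zero.2 hbp
        · exact hw j hab'
  · have hb1 : b p = one := by
      simp only [Fin.lt_def, Fin.ext_iff, Fin.val_zero, ne_eq] at *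
      omega
    have hap : a p = 0 := by
      have := hw p hp
      simp only [Fin.lt_def, Fin.ext_iff, Fin.val_zero, ne_eq] at *
      omega
    have hup : u ≤ p := by
      by_contra hc
      exact ha' p (not_le.1 hc) hap
    by_cases hpu : u = p
    · left
      subst hpu
      -- zeros of `a` after `u` are zeros of `b`
      have hsub : (rset a 0).erase u ⊆ rset b 0 := by
        intro j hj
        rw [mem_erase, mem_rset_zero] at hj
        rw [mem_rset_zero]
        by_contra hbj
        have hne : a j ≠ b j := by rw [hj.2]; exact Ne.symm hbj
        have h3 := hmax j hne
        have h4 : ¬ j < u := fun h => ha' j h hj.2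
        have h5 := hj.1
        simp only [Fin.lt_def, Fin.le_def, Fin.ext_iff, Fin.val_zero, ne_eq] at *
        omega
      have hcard : (rset b 0 \ (rset a 0).erase u).card = 1 := by
        rw [card_sdiff_of_subset hsub, card_erase_of_mem ((mem_rset_zero _ _).2 ha)]
        have h6 : (rset a 0).card = (rset b 0).card := hn
        have : 0 < (rset b 0).card := card_pos.2 ⟨v, (mem_rset_zero _ _).2 hb⟩
        omega
      obtain ⟨v', hv'⟩ := card_eq_one.1 hcard
      have hZ : ∀ j, (b j = 0 ∧ (j = u ∨ a j ≠ 0)) ↔ j = v' := by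
        intro j
        have h10 : j ∈ rset b 0 \ (rset a 0).erase u ↔ j = v' := by rw [hv', mem_singleton]
        rw [mem_sdiff, mem_erase, mem_rset_zero, mem_rset_zero] at h10
        tauto
      have hv'1 := (hZ v').2 rfl
      have hv'u : v' ≠ u := by rintro rfl; exact hbp hv'1.1
      have hav' : a v' ≠ 0 := by tauto
      have h7 := hw v' (by rw [hv'1.1]; exact hav')
      have h7' : a v' = one ∧ v' < u := by
        simp only [Fin.lt_def, Fin.ext_iff, Fin.val_zero, ne_eq] at *
        omega
      have hvv : v = v' := by
        by_contra hne
        have h8 : ¬ v' < v := fun h => hb' v' h hv'1.1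
        have h9 : v < u := lt_of_le_of_lt (not_lt.1 h8) h7'.2
        exact hne ((hZ v).1 ⟨hb, Or.inr (ha' v h9)⟩)
      subst hvv
      funext j
      by_cases hju : j = u
      · subst hju; rw [A2, B1 j (Ne.symm hv'u), hb1]
      · rw [A1 j hju]
        by_cases hjv : j = v
        · rw [hjv, B2, h7'.1]
        · rw [B1 j hjv]
          by_contra hne
          have g1 := hw j hne
          have g2 := hmax j hne
          have g3 := hZ j
          have g4 : a j ≠ 0 := by
            intro h
            have : j ∈ (rset a 0).erase u := by rw [mem_erase, mem_rset_zero]; exact ⟨hju, h⟩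
            have := hsub this
            rw [mem_rset_zero] at this
            exact hne (by rw [h, this])
          have g5 : b j ≠ 0 := by tauto
          simp only [Fin.lt_def, Fin.le_def, Fin.ext_iff, Fin.val_zero, ne_eq] at *
          omega
    · right
      refine plt_of_wit (by omega) p ⟨?_, ?_⟩
      · rw [B1 p hvp, A1 p (Ne.symm hpu), hap]; exact Ne.symm hbp
      · intro j hj
        rw [B1 p hvp, hb1]
        by_cases hju : j = u
        · rw [hju, A2]; right; exact ⟨rfl, lt_of_le_of_ne hup hpu⟩
        · rw [A1 j hju] at hj ⊢
          by_cases hab' : a j = b j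
          · have : j = v := by
              by_contra hjv
              rw [B1 j hjv] at hj; exact hj hab'
            subst this
            left; rw [hab', hb]; exact Fin.pos_iff_ne_zero.2 hone
          · rw [← hb1]; exact hw j hab'

theorem isInitSeg_dShadow {k N : ℕ} {A : Finset (Fin N → Fin (k + 1))} (hA : isInitSeg A) :
    isInitSeg (dShadow A) := by
  intro w hw w2 hw2
  rcases hw2 with rfl | hlt
  · exact hw
  obtain ⟨y, hy, i, hi, h⟩ := mem_dShadow.1 hw
  have hk : 1 < k + 1 := by
    have := (y i).2
    simp only [Fin.ext_iff, Fin.val_zero, ne_eq] at hi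
    omega
  set one : Fin (k + 1) := ⟨1, hk⟩ with hone
  have h1 : (one : ℕ) = 1 := rfl
  have hone0 : one ≠ 0 := by intro h; rw [h] at h1; simp at h1
  have hwz : ∃ i, w i = 0 := ⟨i, by rw [← h]; simp⟩
  have hw2z : ∃ i, w2 i = 0 := by
    have := nz_le_of_plt hlt
    rw [← nz_pos] at *; omega
  obtain ⟨u, hu, hu'⟩ := exists_first_zero hwz
  obtain ⟨u2, hu2, hu2'⟩ := exists_first_zero hw2z
  have hm := zmin_mono h1 hu2 hu2' hu hu' hlt
  have hz : y = Function.update w u one ∨ plt (Function.update w u one) y := by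
    refine parent_ge (good_update h1 hu') hi ?_
    rw [h]; simp [← hu]
  have hzA : Function.update w u one ∈ A :=
    hA y hy _ (by rcases hz with h | h; exacts [Or.inl h.symm, Or.inr h])
  have hz2A := hA _ hzA _ hm
  exact mem_dShadow.2 ⟨_, hz2A, u2, by simpa using hone0, by simp [← hu2]⟩

/-! ### Compression does not increase the shadow -/

theorem card_union_initSeg_le {k N m : ℕ} {B C : Finset (Fin N → Fin (k + 1))} (hB : isInitSeg B)
    (hC : isInitSeg C) (h1 : B.card ≤ m) (h2 : C.card ≤ m) : (B ∪ C).card ≤ m := by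
  rcases initSeg_nested hB hC with h | h
  · rwa [Finset.union_eq_right.2 h]
  · rwa [Finset.union_eq_left.2 h]

theorem card_biUnion_initSeg_le {k N m : ℕ} {ι : Type} (S : Finset ι)
    (f : ι → Finset (Fin N → Fin (k + 1))) (hf : ∀ i ∈ S, isInitSeg (f i))
    (hm : ∀ i ∈ S, (f i).card ≤ m) : isInitSeg (S.biUnion f) ∧ (S.biUnion f).card ≤ m := by
  induction S using Finset.induction_on with
  | empty => simp [isInitSeg]
  | insert a S ha ih =>
    rw [Finset.biUnion_insert]
    obtain ⟨h1, h2⟩ := ih (fun i hi => hf i (mem_insert_of_mem hi))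
      (fun i hi => hm i (mem_insert_of_mem hi))
    have h3 := hf a (mem_insert_self _ _)
    exact ⟨isInitSeg_union h3 h1, card_union_initSeg_le h3 h1 (hm a (mem_insert_self _ _)) h2⟩

/-- the vertex-isoperimetric statement in dimension `N` -/
def Iso (k N : ℕ) : Prop := ∀ A : Finset (Fin N → Fin (k + 1)),
  (dShadow (initSeg k N A.card)).card ≤ (dShadow A).card

theorem dShadow_compress_le {k n : ℕ} (hT : Iso k n) (s : Fin (n + 1))
    (A : Finset (Fin (n + 1) → Fin (k + 1))) :
    (dShadow (compress s A)).card ≤ (dShadow A).card := by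
  rw [card_cslice s, card_cslice s (dShadow A)]
  refine Finset.sum_le_sum fun t _ => ?_
  by_cases ht : t = 0
  · subst ht
    rw [slice_dShadow_zero]
    have hb := card_biUnion_initSeg_le (m := (cslice s 0 (dShadow A)).card)
      (univ.filter fun t : Fin (k + 1) => t ≠ 0) (fun t => cslice s t (compress s A))
      (by intro t _; rw [slice_compress]; exact initSeg_isInitSeg _ _ _)
      (by
        intro t ht
        rw [slice_compress, card_initSeg_card, slice_dShadow_zero]
        exact card_le_card ((subset_biUnion_of_mem (fun t => cslice s t A) ht).trans
          subset_union_right))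
    refine card_union_initSeg_le ?_ hb.1 ?_ hb.2
    · rw [slice_compress]; exact isInitSeg_dShadow (initSeg_isInitSeg _ _ _)
    · rw [slice_compress, slice_dShadow_zero]
      exact (hT _).trans (card_le_card subset_union_left)
  · rw [slice_dShadow_ne _ _ ht, slice_dShadow_ne _ _ ht, slice_compress]
    exact hT _

/-! ### Swapping -/

/-- `w = update y j 0` is already covered by smaller points if `j` is not good. -/
theorem not_good_covered {k N : ℕ} {y : Fin N → Fin (k + 1)} {j : Fin N} (hj : y j ≠ 0)
    (hg : ¬ good y j) : ∃ z i, plt z y ∧ z i ≠ 0 ∧ Function.update z i 0 = Function.update y j 0 := by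
  have hk : 1 < k + 1 := by
    have := (y j).2
    simp only [Fin.ext_iff, Fin.val_zero, ne_eq] at hj
    omega
  by_cases h1 : (y j : ℕ) = 1
  · have : ∃ u < j, y u = 0 := by
      by_contra hc
      push Not at hc
      exact hg ⟨h1, hc⟩
    obtain ⟨u, huj, hu⟩ := this
    have hu' : Function.update y j 0 u = 0 := by simp [huj.ne, hu]
    refine ⟨Function.update (Function.update y j 0) u (y j), u, ?_, by simpa using hj, ?_⟩
    · have e1 := nz_update_zero y j hj
      have e2 := nz_update_of_zero (Function.update y j 0) u (y j) hu' hj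
      refine plt_of_wit (by omega) j ⟨?_, ?_⟩
      · simp [huj.ne', Ne.symm hj]
      · intro l hl
        by_cases hlu : l = u
        · subst hlu; right; simpa using huj
        · by_cases hlj : l = j
          · subst hlj; left; simpa [hlu] using Fin.pos_iff_ne_zero.2 hj
          · simp [hlu, hlj] at hl
    · rw [Function.update_idem, Function.update_eq_self_iff]; exact hu'.symm
  · refine ⟨Function.update y j ⟨1, hk⟩, j, ?_, ?_, by simp⟩
    · apply update_plt
      · simp [Fin.ext_iff]
      · simp only [Fin.ext_iff, Fin.lt_def, Fin.val_zero, ne_eq] at *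
        omega
    · simp [Fin.ext_iff]

/-- minimality of a configuration -/
def Mini {k N : ℕ} (B : Finset (Fin N → Fin (k + 1))) : Prop :=
  ∀ C : Finset (Fin N → Fin (k + 1)), C.card = B.card → (dShadow C).card ≤ (dShadow B).card →
    ∑ x ∈ B, rk x ≤ ∑ x ∈ C, rk x

theorem single_swap {k N : ℕ} {B : Finset (Fin N → Fin (k + 1))} (hB : Mini B)
    {x y : Fin N → Fin (k + 1)} (hx : x ∈ B) (hxmax : ∀ z ∈ B, ¬ plt x z) (hy : y ∉ B)
    (hymin : ∀ z, plt z y → z ∈ B) (hyx : plt y x)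
    (hcard : ((univ.filter (good y)).image (fun j => Function.update y j 0) \ dShadow B).card ≤
      (univ.filter (good x)).card) : False := by
  have hxy : x ≠ y := by rintro rfl; exact hy hx
  have hy' : y ∉ B.erase x := fun h => hy (mem_of_mem_erase h)
  have hs : ∑ z ∈ insert y (B.erase x), rk z < ∑ z ∈ B, rk z := by
    rw [sum_insert hy', ← Finset.add_sum_erase B rk hx]
    have := (plt_rk _ _).1 hyx
    omega
  refine absurd (hB (insert y (B.erase x)) ?_ ?_) (not_le.2 hs)
  · rw [card_insert_of_notMem hy', card_erase_of_mem hx]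
    have := card_pos.2 ⟨x, hx⟩
    omega
  set L := (univ.filter (good x)).image (fun j => Function.update x j 0) with hL
  set G := (univ.filter (good y)).image (fun j => Function.update y j 0) \ dShadow B with hG
  have hne : ∀ j, good x j → x j ≠ 0 := by
    intro j hj h; have := hj.1; rw [h] at this; simp at this
  have hLc : L.card = (univ.filter (good x)).card := by
    rw [hL]
    apply card_image_of_injOn
    intro i hi j hj hij
    simp only [coe_filter, mem_univ, true_and, Set.mem_ofPred_eq] at hi hj
    by_contra hc
    have := congrFun hij i
    simp [hc] at this
    exact hne i hi this.symm
  have hLB : L ⊆ dShadow B := by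
    intro w hw
    simp only [hL, mem_image, mem_filter, mem_univ, true_and] at hw
    obtain ⟨j, hj, rfl⟩ := hw
    exact mem_dShadow.2 ⟨x, hx, j, hne j hj, rfl⟩
  have hsub : dShadow (insert y (B.erase x)) ⊆ (dShadow B \ L) ∪ G := by
    intro w hw
    have hwL : w ∉ L := by
      intro hwL
      simp only [hL, mem_image, mem_filter, mem_univ, true_and] at hwL
      obtain ⟨j, hj, rfl⟩ := hwL
      obtain ⟨z, hz, i, hi, h⟩ := mem_dShadow.1 hw
      have h2 := parent_ge hj hi h
      rcases mem_insert.1 hz with rfl | hz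
      · rcases h2 with h2 | h2
        · exact hxy h2.symm
        · exact plt_irrefl _ (plt_trans hyx h2)
      · rcases h2 with h2 | h2
        · exact (mem_erase.1 hz).1 h2
        · exact hxmax z (mem_of_mem_erase hz) h2
    by_cases hwB : w ∈ dShadow B
    · exact mem_union_left _ (mem_sdiff.2 ⟨hwB, hwL⟩)
    · apply mem_union_right
      rw [hG, mem_sdiff]
      refine ⟨?_, hwB⟩
      obtain ⟨z, hz, i, hi, h⟩ := mem_dShadow.1 hw
      rcases mem_insert.1 hz with rfl | hz
      · refine mem_image.2 ⟨i, mem_filter.2 ⟨mem_univ _, ?_⟩, h⟩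
        by_contra hg
        obtain ⟨v, l, hv, hl, he⟩ := not_good_covered hi hg
        exact hwB (mem_dShadow.2 ⟨v, hymin v hv, l, hl, he.trans h⟩)
      · exact absurd (mem_dShadow.2 ⟨z, mem_of_mem_erase hz, i, hi, h⟩) hwB
  have h1 := card_le_card hsub
  have h2 := card_union_le (dShadow B \ L) G
  have h3 := card_sdiff_of_subset hLB
  have h4 := card_le_card hLB
  omega

/-! ### Structure of the extremal pair -/

theorem pair_aux {k N : ℕ} {x y : Fin N → Fin (k + 1)} (hyx : plt y x) (hd : ∀ j, y j ≠ x j)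
    (hno : ∀ z, plt y z → plt z x → (∃ i, z i = y i) → (∃ i, z i = x i) → False)
    {s : Fin N} (hg : good y s)
    (h3 : (∀ a b : Fin N, ∃ c, c ≠ a ∧ c ≠ b) ∨ ∀ j, y j ≠ 0) : x s ≠ 0 := by
  intro hxs
  obtain ⟨hys, hlow⟩ := hg
  have hle := nz_le_of_plt hyx
  have hys0 : y s ≠ 0 := by intro h; rw [h] at hys; simp at hys
  have hxpos : 0 < nz x := nz_pos.2 ⟨s, hxs⟩
  obtain ⟨q0, hq0⟩ := (nz_pos (x := y)).1 (by omega)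
  have h3' : ∀ a b : Fin N, ∃ c, c ≠ a ∧ c ≠ b := by
    rcases h3 with h | h
    · exact h
    · exact absurd hq0 (h q0)
  have key : ∀ q, y q = 0 → q ≠ s ∧
      nz (Function.update (Function.update y s 0) q (y s)) = nz y ∧
      ¬ plt (Function.update (Function.update y s 0) q (y s)) x := by
    intro q hq
    have hqs : q ≠ s := by rintro rfl; exact hys0 hq
    have hsq : s < q := by
      by_contra hc
      exact hlow q (lt_of_le_of_ne (not_lt.1 hc) hqs) hq
    have hq' : Function.update y s 0 q = 0 := by simp [hqs, hq]
    have e1 := nz_update_zero y s hys0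
    have e2 := nz_update_of_zero (Function.update y s 0) q (y s) hq' hys0
    refine ⟨hqs, by omega, fun hlt => ?_⟩
    obtain ⟨c, hcs, hcq⟩ := h3' s q
    refine hno _ ?_ hlt ⟨c, by simp [hcs, hcq]⟩ ⟨s, by simp [hqs.symm, hxs]⟩
    refine plt_of_wit (by omega) q ⟨by simp [hq, hys0.symm], ?_⟩
    intro l hl
    by_cases hlq : l = q
    · subst hlq; left; simpa [hq] using Fin.pos_iff_ne_zero.2 hys0
    · by_cases hls : l = s
      · subst hls; right; simpa using hsq
      · simp [hlq, hls] at hl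
  by_cases hn : nz y = nz x
  swap
  · obtain ⟨-, h1, h2⟩ := key q0 hq0
    exact h2 ((plt_iff _ _).2 (Or.inl (by omega)))
  obtain ⟨p, ⟨hp, hw⟩, hmax⟩ := exists_wit hyx hn
  have hxp : x p ≠ 0 := by
    intro h
    have := hw p hp
    simp only [Fin.lt_def, Fin.ext_iff, Fin.val_zero, ne_eq] at *
    omega
  have hps : p ≠ s := by rintro rfl; exact hxp hxs
  by_cases hx2 : 2 ≤ (x p : ℕ)
  · obtain ⟨hqs, h1, h2⟩ := key q0 hq0
    refine h2 (plt_of_wit (by omega) p ⟨?_, ?_⟩)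
    · by_cases hpq : p = q0
      · subst hpq
        simp only [Function.update_self, ne_eq, Fin.ext_iff]; omega
      · simpa [hpq, hps] using hp
    · intro l hl
      by_cases hlq : l = q0
      · subst hlq; left; simp only [Function.update_self, Fin.lt_def]; omega
      · by_cases hls : l = s
        · subst hls; simp [hlq, hxs] at hl
        · simpa [hlq, hls] using hw l (hd l)
  · have hx1 : (x p : ℕ) = 1 := by
      simp only [Fin.ext_iff, Fin.val_zero, ne_eq] at hxp
      omega
    have hq : ∃ q, y q = 0 ∧ q ≠ p := by
      obtain ⟨c, hcs, hcp⟩ := h3' s p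
      by_cases hyc : y c = 0
      · exact ⟨c, hyc, hcp⟩
      · have hxc : x c = 0 := by
          have h1 := hw c (hd c)
          have h2 := hmax c (hd c)
          have h3 := hd c
          simp only [Fin.lt_def, Fin.ext_iff, Fin.val_zero, ne_eq] at *
          omega
        have : 1 < (rset x 0).card := one_lt_card.2
          ⟨c, (mem_rset_zero _ _).2 hxc, s, (mem_rset_zero _ _).2 hxs, hcs⟩
        have h4 : 1 < (rset y 0).card := by
          have h5 : (rset y 0).card = (rset x 0).card := hn
          omega
        obtain ⟨q, hq, hqp⟩ := Finset.exists_mem_ne h4 p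
        exact ⟨q, (mem_rset_zero _ _).1 hq, hqp⟩
    obtain ⟨q, hq, hqp⟩ := hq
    obtain ⟨hqs, h1, h2⟩ := key q hq
    have hxq : y s = x q := by
      have h1 := hd q
      have h2 := hmax q (hd q)
      simp only [Fin.lt_def, Fin.ext_iff, Fin.val_zero, ne_eq] at *
      omega
    refine h2 (plt_of_wit (by omega) p ⟨?_, ?_⟩)
    · simpa [hqp.symm, hps] using hp
    · intro l hl
      by_cases hlq : l = q
      · subst hlq; simp [hxq] at hl
      · by_cases hls : l = s
        · subst hls; simp [hlq, hxs] at hl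
        · simpa [hlq, hls] using hw l (hd l)

theorem pair_main {k N : ℕ} {x y : Fin N → Fin (k + 1)} (hyx : plt y x) (hd : ∀ j, y j ≠ x j)
    (hno : ∀ z, plt y z → plt z x → (∃ i, z i = y i) → (∃ i, z i = x i) → False)
    {s : Fin N} (hg : good y s) (h2 : ∃ a, a ≠ s)
    (h3 : (∀ a b : Fin N, ∃ c, c ≠ a ∧ c ≠ b) ∨ ∀ j, y j ≠ 0) :
    wit y x s ∧ (∀ j, y j ≠ 0) ∧ (∀ j, x j ≠ 0) ∧ ∀ j, j ≠ s → x j < y j := by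
  have hxs := pair_aux hyx hd hno hg h3
  obtain ⟨hys, hlow⟩ := hg
  obtain ⟨a, has⟩ := h2
  have hle := nz_le_of_plt hyx
  have hys0 : y s ≠ 0 := by intro h; rw [h] at hys; simp at hys
  have hlt : y s < x s := by
    have := hd s
    simp only [Fin.lt_def, Fin.ext_iff, Fin.val_zero, ne_eq] at *
    omega
  have e1 := nz_update_same y s (x s) hys0 hxs
  have hnot : ¬ plt (Function.update y s (x s)) x := fun h =>
    hno _ (plt_update y s (x s) hys0 hlt) h ⟨a, by simp [has]⟩ ⟨s, by simp⟩
  have hn : nz y = nz x := by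
    by_contra hc
    exact hnot ((plt_iff _ _).2 (Or.inl (by omega)))
  obtain ⟨p, ⟨hp, hw⟩, hmax⟩ := exists_wit hyx hn
  have hps : p = s := by
    by_contra hps
    refine hnot (plt_of_wit (by omega) p ⟨by simpa [hps] using hp, ?_⟩)
    intro l hl
    by_cases hls : l = s
    · subst hls; simp at hl
    · simpa [hls] using hw l (hd l)
  subst hps
  have hy0 : ∀ j, y j ≠ 0 := by
    intro q hq
    have hqs : q ≠ p := by rintro rfl; exact hys0 hq
    have hsq : p < q := by
      by_contra hc
      exact hlow q (lt_of_le_of_ne (not_lt.1 hc) hqs) hq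
    have hxq : x q ≠ 0 := by rw [← hq]; exact (hd q).symm
    have hq' : Function.update y p 0 q = 0 := by simp [hqs, hq]
    have e1 := nz_update_zero y p hys0
    have e2 := nz_update_of_zero (Function.update y p 0) q (x q) hq' hxq
    have h3' : ∀ a b : Fin N, ∃ c, c ≠ a ∧ c ≠ b := by
      rcases h3 with h | h
      · exact h
      · exact absurd hq (h q)
    obtain ⟨c, hcs, hcq⟩ := h3' p q
    refine hno (Function.update (Function.update y p 0) q (x q)) ?_ ?_
      ⟨c, by simp [hcs, hcq]⟩ ⟨q, by simp⟩
    · refine plt_of_wit (by omega) q ⟨by simpa using hd q, ?_⟩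
      intro l hl
      by_cases hlq : l = q
      · subst hlq; left; simpa [hq] using Fin.pos_iff_ne_zero.2 hxq
      · by_cases hls : l = p
        · subst hls
          simp only [Function.update_self, Fin.lt_def, Fin.ext_iff, Fin.val_zero, ne_eq] at *
          omega
        · simp [hlq, hls] at hl
    · refine plt_of_wit (by omega) p ⟨by simpa [hqs.symm] using hxs.symm, ?_⟩
      intro l hl
      by_cases hlq : l = q
      · subst hlq; simp at hl
      · by_cases hls : l = p
        · subst hls; left; simpa [hlq] using Fin.pos_iff_ne_zero.2 hxs
        · simpa [hlq, hls] using hw l (hd l)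
  have hx0 : ∀ j, x j ≠ 0 := by
    intro j hj
    have : 0 < nz x := nz_pos.2 ⟨j, hj⟩
    obtain ⟨i, hi⟩ := (nz_pos (x := y)).1 (by omega)
    exact hy0 i hi
  refine ⟨⟨hp, hw⟩, hy0, hx0, fun j hj => ?_⟩
  by_contra hc
  have hlt' : y j < x j := lt_of_le_of_ne (not_lt.1 hc) (hd j)
  refine hno (Function.update x j (y j)) ?_ (update_plt x j (y j) (hy0 j) hlt') ⟨j, by simp⟩
    ⟨p, by simp [Ne.symm hj]⟩
  have e3 := nz_update_same x j (y j) (hx0 j) (hy0 j)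
  refine plt_of_wit (by omega) p ⟨by simpa [Ne.symm hj] using hp, ?_⟩
  intro l hl
  simpa [Ne.symm hj] using hw l (hd l)

/-! ### The batch swap -/

theorem batch_swap {k N : ℕ} {B : Finset (Fin N → Fin (k + 1))} (hB : Mini B) (hP : HP B)
    {x y : Fin N → Fin (k + 1)} (hx : x ∈ B) (hxmax : ∀ z ∈ B, ¬ plt x z) (hy : y ∉ B)
    (hymin : ∀ z, plt z y → z ∈ B) {s u : Fin N} (hys : (y s : ℕ) = 1) (hwit : wit y x s)
    (hy0 : ∀ j, y j ≠ 0) (hx0 : ∀ j, x j ≠ 0) (hlt : ∀ j, j ≠ s → x j < y j) (hus : u ≠ s)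
    (hmin : ∀ j, j ≠ s → x u ≤ x j) : False := by
  obtain ⟨hp, hw⟩ := hwit
  set Cs := univ.filter (fun c : Fin (k + 1) => c ≠ 0 ∧ c ≤ x u) with hCs
  have hC : ∀ c, c ∈ Cs ↔ c ≠ 0 ∧ c ≤ x u := by intro c; simp [hCs]
  set X := Cs.image (Function.update x u) with hX
  set Y := Cs.image (Function.update y s) with hY
  have hxus : x u < x s := by
    have h1 := hlt u hus
    have h2 := hw u h1.ne'
    simp only [Fin.lt_def, Fin.ext_iff] at *
    omega
  have hXB : X ⊆ B := by
    intro z hz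
    obtain ⟨c, hc, rfl⟩ := mem_image.1 hz
    obtain ⟨hc0, hcu⟩ := (hC c).1 hc
    rcases hcu.eq_or_lt with h | h
    · rw [h]; simpa using hx
    · exact hP x hx _ (update_plt x u c hc0 h) ⟨s, by simp [hus.symm]⟩
  have hYB : ∀ z ∈ Y, z ∉ B := by
    intro z hz hzB
    obtain ⟨c, hc, rfl⟩ := mem_image.1 hz
    obtain ⟨hc0, hcu⟩ := (hC c).1 hc
    by_cases h : c = y s
    · rw [h] at hzB; exact hy (by simpa using hzB)
    · refine hy (hP _ hzB y (plt_update y s c (hy0 s) ?_) ⟨u, by simp [hus]⟩)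
      simp only [Fin.lt_def, Fin.ext_iff, Fin.val_zero, ne_eq] at *
      omega
  have hXc : X.card = Cs.card := card_image_of_injective _ (Function.update_injective _ _)
  have hYc : Y.card = Cs.card := card_image_of_injective _ (Function.update_injective _ _)
  have hdis : Disjoint (B \ X) Y := by
    rw [Finset.disjoint_left]
    intro z hz hz'
    exact hYB z hz' (mem_sdiff.1 hz).1
  have hnx : nz x = 0 := by
    by_contra h
    obtain ⟨i, hi⟩ := nz_pos.1 (Nat.pos_of_ne_zero h)
    exact hx0 i hi
  have hny : nz y = 0 := by
    by_contra h
    obtain ⟨i, hi⟩ := nz_pos.1 (Nat.pos_of_ne_zero h)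
    exact hy0 i hi
  have hlt' : ∀ c ∈ Cs, rk (Function.update y s c) < rk (Function.update x u c) := by
    intro c hc
    obtain ⟨hc0, hcu⟩ := (hC c).1 hc
    have hcs : c < x s := lt_of_le_of_lt hcu hxus
    rw [← plt_rk]
    have e1 := nz_update_same y s c (hy0 s) hc0
    have e2 := nz_update_same x u c (hx0 u) hc0
    refine plt_of_wit (by omega) s ⟨?_, ?_⟩
    · simpa [hus.symm] using hcs.ne
    · intro l hl
      by_cases hls : l = s
      · subst hls; left; simpa [hus.symm] using hcs
      · simpa [hls, hus.symm] using hw l (hlt l hls).ne'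
  have hsum : ∑ z ∈ Y, rk z < ∑ z ∈ X, rk z := by
    rw [hX, hY, sum_image (fun a _ b _ h => Function.update_injective _ _ h),
      sum_image (fun a _ b _ h => Function.update_injective _ _ h)]
    exact sum_lt_sum_of_nonempty ⟨x u, (hC _).2 ⟨hx0 u, le_rfl⟩⟩ hlt'
  have hs : ∑ z ∈ (B \ X) ∪ Y, rk z < ∑ z ∈ B, rk z := by
    rw [sum_union hdis, ← Finset.sum_sdiff hXB]
    omega
  refine absurd (hB ((B \ X) ∪ Y) ?_ ?_) (not_le.2 hs)
  · rw [card_union_of_disjoint hdis, card_sdiff_of_subset hXB]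
    have := card_le_card hXB
    omega
  have hmem : Function.update x u 0 ∈ dShadow B := mem_dShadow.2 ⟨x, hx, u, hx0 u, rfl⟩
  have hsub : dShadow ((B \ X) ∪ Y) ⊆
      insert (Function.update y s 0) ((dShadow B).erase (Function.update x u 0)) := by
    intro w hw'
    obtain ⟨z, hz, i, hi, h⟩ := mem_dShadow.1 hw'
    rcases mem_union.1 hz with hz | hz
    · obtain ⟨hzB, hzX⟩ := mem_sdiff.1 hz
      refine mem_insert_of_mem (mem_erase.2 ⟨?_, mem_dShadow.2 ⟨z, hzB, i, hi, h⟩⟩)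
      intro hc
      rw [← h] at hc
      have hiu : i = u := by
        by_contra hiu
        have := congrFun hc i
        simp [hiu] at this
        exact hx0 i this.symm
      subst hiu
      have hzx : z = Function.update x i (z i) := by
        funext l
        by_cases hl : l = i
        · subst hl; simp
        · have := congrFun hc l
          simpa [hl] using this
      by_cases hzc : z i ≤ x i
      · exact hzX (mem_image.2 ⟨z i, (hC _).2 ⟨hi, hzc⟩, hzx.symm⟩)
      · refine hxmax z hzB ?_
        rw [hzx]
        exact plt_update x i (z i) (hx0 i) (not_le.1 hzc)
    · obtain ⟨c, hc, rfl⟩ := mem_image.1 hz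
      obtain ⟨hc0, hcu⟩ := (hC c).1 hc
      by_cases his : i = s
      · subst his
        rw [← h]; simp
      · have hci : c < y i := lt_of_le_of_lt (hcu.trans (hmin i his)) (hlt i his)
        have hsi : y s < y i := by
          have h1 := hlt i his
          have h2 := hx0 i
          simp only [Fin.lt_def, Fin.ext_iff, Fin.val_zero, ne_eq] at *
          omega
        refine mem_insert_of_mem (mem_erase.2 ⟨?_, ?_⟩)
        · rw [← h]
          intro hc'
          have := congrFun hc' s
          simp [Ne.symm his, hus.symm] at this
          exact (lt_of_le_of_lt hcu hxus).ne this
        · refine mem_dShadow.2 ⟨Function.update (Function.update y s c) i (y s), hymin _ ?_, i,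
            by simpa using hy0 s, by rw [Function.update_idem, h]⟩
          have e1 := nz_update_same y s c (hy0 s) hc0
          have e2 := nz_update_same (Function.update y s c) i (y s) hi (hy0 s)
          refine plt_of_wit (by omega) i ⟨by simpa using hsi.ne, ?_⟩
          intro l hl
          by_cases hli : l = i
          · subst hli; left; simpa using hsi
          · by_cases hls : l = s
            · subst hls; left; simpa [hli] using hci
            · simp [hli, hls] at hl
  have h1 := card_le_card hsub
  have h2 := card_insert_le (Function.update y s 0) ((dShadow B).erase (Function.update x u 0))
  have h3 := card_erase_of_mem hmem
  have h4 := card_pos.2 ⟨_, hmem⟩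
  omega

/-! ### The main argument -/

theorem isInitSeg_of_mini {k N : ℕ} {B : Finset (Fin N → Fin (k + 1))} (hB : Mini B)
    (hP : HP B) : isInitSeg B := by
  by_contra hnot
  unfold isInitSeg at hnot
  push Not at hnot
  obtain ⟨b, hb, a, hab, ha⟩ := hnot
  obtain ⟨x, hx, hxm⟩ := exists_max_image B rk ⟨b, hb⟩
  obtain ⟨y, hy, hym⟩ := exists_min_image Bᶜ rk ⟨a, mem_compl.2 ha⟩
  rw [mem_compl] at hy
  have hyx : plt y x := by
    rw [plt_rk]
    have h1 := hxm b hb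
    have h2 := hym a (mem_compl.2 ha)
    rw [ple_rk] at hab
    have h3 : rk y ≠ rk x := fun h => hy (by rw [rk_inj h]; exact hx)
    omega
  have hxmax : ∀ z ∈ B, ¬ plt x z := by
    intro z hz h
    rw [plt_rk] at h
    have := hxm z hz
    omega
  have hymin : ∀ z, plt z y → z ∈ B := by
    intro z hz
    by_contra h
    rw [plt_rk] at hz
    have := hym z (mem_compl.2 h)
    omega
  have hd : ∀ j, y j ≠ x j := fun j h => hy (hP x hx y hyx ⟨j, h.symm⟩)
  have hno : ∀ z, plt y z → plt z x → (∃ i, z i = y i) → (∃ i, z i = x i) → False := by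
    rintro z h1 h2 h3 ⟨i, hi⟩
    exact hy (hP z (hP x hx z h2 ⟨i, hi.symm⟩) y h1 h3)
  have hswap : ¬ ∀ j, good y j → Function.update y j 0 ∈ dShadow B := by
    intro h
    refine single_swap hB hx hxmax hy hymin hyx ?_
    have : (univ.filter (good y)).image (fun j => Function.update y j 0) \ dShadow B = ∅ := by
      rw [sdiff_eq_empty_iff_subset]
      intro w hw
      simp only [mem_image, mem_filter, mem_univ, true_and] at hw
      obtain ⟨j, hj, rfl⟩ := hw
      exact h j hj
    rw [this]; simp
  have hle := nz_le_of_plt hyx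
  apply hswap
  intro s hg
  exfalso
  have hne : ∀ j, good y j → y j ≠ 0 := by
    intro j hj h; have := hj.1; rw [h] at this; simp at this
  have h2 : ∃ a, a ≠ s := by
    by_contra hc
    push Not at hc
    apply hswap
    intro j hj
    have hxs : x s ≠ 0 := by
      intro h
      have : 0 < nz x := nz_pos.2 ⟨s, h⟩
      obtain ⟨i, hi⟩ := (nz_pos (x := y)).1 (by omega)
      rw [hc i] at hi
      exact hne s hg hi
    refine mem_dShadow.2 ⟨x, hx, s, hxs, ?_⟩
    funext l
    rw [hc l, hc j]; simp
  have h3 : (∀ a b : Fin N, ∃ c, c ≠ a ∧ c ≠ b) ∨ ∀ j, y j ≠ 0 := by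
    by_contra hc
    push Not at hc
    obtain ⟨⟨a, b, hab⟩, q, hq⟩ := hc
    apply hswap
    intro j hj
    have hjq : j ≠ q := by rintro rfl; exact hne j hj hq
    have hall : ∀ c, c ≠ j → c = q := by
      intro c hcj
      have h1 := hab c
      have h2 := hab j
      have h3 := hab q
      grind
    have hxq : x q ≠ 0 := by rw [← hq]; exact (hd q).symm
    by_cases hxj : x j = 0
    · refine mem_dShadow.2 ⟨x, hx, q, hxq, ?_⟩
      funext l
      by_cases hl : l = j
      · subst hl; simp [hjq, hxj]
      · rw [hall l hl]; simp [hjq.symm, hq]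
    · have hz : Function.update x j 0 ∈ B := by
        refine hP x hx _ ((plt_iff _ _).2 (Or.inl ?_)) ⟨q, by simp [hjq.symm]⟩
        rw [nz_update_zero x j hxj]; omega
      refine mem_dShadow.2 ⟨_, hz, q, by simpa [hjq.symm] using hxq, ?_⟩
      funext l
      by_cases hl : l = j
      · subst hl; simp [hjq]
      · rw [hall l hl]; simp [hjq.symm, hq]
  obtain ⟨hwit, hy0, hx0, hlt⟩ := pair_main hyx hd hno hg h2 h3
  obtain ⟨a, ha⟩ := h2
  obtain ⟨u, hu, hmin⟩ := exists_min_image (univ.filter fun j => j ≠ s) x ⟨a, by simpa using ha⟩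
  simp only [mem_filter, mem_univ, true_and] at hu hmin
  exact batch_swap hB hP hx hxmax hy hymin hg.1 hwit hy0 hx0 hlt hu hmin

theorem iso_all (k N : ℕ) : Iso k N := by
  induction N with
  | zero =>
    intro A
    have : dShadow (initSeg k 0 A.card) = ∅ := by
      rw [eq_empty_iff_forall_notMem]
      intro w hw
      obtain ⟨_, _, i, _⟩ := mem_dShadow.1 hw
      exact i.elim0
    rw [this]; simp
  | succ n ih =>
    intro A
    obtain ⟨B, hBm, hmin⟩ := exists_min_image
      (univ.filter fun C : Finset (Fin (n + 1) → Fin (k + 1)) =>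
        C.card = A.card ∧ (dShadow C).card ≤ (dShadow A).card)
      (fun C => ∑ x ∈ C, rk x) ⟨A, by simp⟩
    simp only [mem_filter, mem_univ, true_and] at hBm hmin
    have hB : Mini B := fun C h1 h2 => hmin C ⟨h1.trans hBm.1, h2.trans hBm.2⟩
    have hcomp : IsCompressed B := by
      intro s
      by_contra hne
      exact absurd (hB _ (card_compress s B) (dShadow_compress_le ih s B))
        (not_le.2 (compress_sum_lt s B hne))
    have := initSeg_unique (isInitSeg_of_mini hB (HP_of_isCompressed hcomp))
    rw [← hBm.1, this]
    exact hBm.2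

/-- **Claim 2.** Let `k ≥ 1` and `n ≥ 2` and let `A ⊆ [k]^n`. Then there exists a
compressed set `B ⊆ [k]^n` with `|B| = |A|` and `|d(A)| ≥ |d(B)|`.
(Dimension `n ≥ 2` is rendered as `n + 1` with `n ≥ 1`; alphabet `[k]`, `k ≥ 1`,
as `Fin (k+1)`.) -/
theorem claim2_exists_compressed (k n : ℕ) (hn : 1 ≤ n)
    (A : Finset (Fin (n + 1) → Fin (k + 1))) :
    ∃ B : Finset (Fin (n + 1) → Fin (k + 1)),
      IsCompressed B ∧ B.card = A.card ∧ (dShadow B).card ≤ (dShadow A).card := by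
  exact ⟨initSeg k (n + 1) A.card, isCompressed_of_isInitSeg (initSeg_isInitSeg _ _ _),
    card_initSeg_card A, iso_all k (n + 1) A⟩
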